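/- Let λ and μ be partitions with conjugates λ' and μ' (where λ'_j := #{i ≥ 1 : λ_i ≥ j}). Let q ∈ ℕ be such that λ_i = μ_i = 0 for all i > q, and let p ∈ ℕ be such that λ'_j = μ'_j = 0 for all j > p (equivalently λ_1 ≤ p and μ_1 ≤ p). Then S_q(λ,μ;0) equals the determinant of the p×p matrix whose (i,j) entry (1 ≤ i,j ≤ p) is e(λ'_i − μ'_j − i + j, −μ'_j + j − 1). (This is the dual Jacobi–Trudi identity for the ninth-variation Schur functions.) -/

import Mathlib

/-- The base ring of the ninth variation: polynomials over `ℤ` in indeterminates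
`X_{(r,s)}` indexed by pairs of a positive integer `r` and an integer `s`. -/
abbrev NinthR : Type := MvPolynomial ({r : ℤ // 0 < r} × ℤ) ℤ

/-- `hfun r s` is `h_{r,s}`: the indeterminate `X_{(r,s)}` if `r > 0`, `1` if `r = 0`,
and `0` if `r < 0`. -/
noncomputable def hfun (r s : ℤ) : NinthR :=
  if hr : 0 < r then MvPolynomial.X (⟨r, hr⟩, s) else if r = 0 then 1 else 0

/-- The ninth-variation skew Schur function `S_n(λ,μ;s)`: the determinant of the
`n × n` matrix whose `(i,j)` entry (`1 ≤ i,j ≤ n`, here encoded by `Fin n` with the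
`1`-based index `(i : ℕ) + 1`) is `h(λ_i − μ_j − i + j, μ_j − j + 1 + s)`.
Partitions are encoded as functions `ℕ → ℕ` whose relevant values are at indices
`1, 2, 3, …`. -/
noncomputable def Svar (n : ℕ) (l m : ℕ → ℕ) (s : ℤ) : NinthR :=
  Matrix.det (Matrix.of fun i j : Fin n =>
    hfun ((l ((i : ℕ) + 1) : ℤ) - (m ((j : ℕ) + 1) : ℤ)
        - (((i : ℕ) : ℤ) + 1) + (((j : ℕ) : ℤ) + 1))
      ((m ((j : ℕ) + 1) : ℤ) - (((j : ℕ) : ℤ) + 1) + 1 + s))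

/-- The elementary function `e(r,s)`: for `r ≥ 0` it is the determinant of the `r × r`
matrix with `(i,j)` entry `h(1 − i + j, 1 − j + s)` (so `e(0,s) = 1`), and `e(r,s) = 0`
for `r < 0`. -/
noncomputable def evar (r s : ℤ) : NinthR :=
  if 0 ≤ r then
    Matrix.det (Matrix.of fun i j : Fin r.toNat =>
      hfun (1 - (((i : ℕ) : ℤ) + 1) + (((j : ℕ) : ℤ) + 1))
        (1 - (((j : ℕ) : ℤ) + 1) + s))
  else 0

/-- The conjugate partition: `conjP l j = #{i ≥ 1 : l i ≥ j}`. -/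
noncomputable def conjP (l : ℕ → ℕ) (j : ℕ) : ℕ :=
  Set.ncard {i : ℕ | 1 ≤ i ∧ j ≤ l i}

open Matrix in
/-- Jacobi's complementary minor theorem, in block form. -/
theorem det_toBlocks₁₁_eq_det_mul_det_toBlocks₂₂ {m n R : Type*} [CommRing R]
    [Fintype m] [DecidableEq m] [Fintype n] [DecidableEq n]
    {A B : Matrix (m ⊕ n) (m ⊕ n) R} (hAB : A * B = 1) :
    A.toBlocks₁₁.det = A.det * B.toBlocks₂₂.det := by
  have hA := fromBlocks_toBlocks A
  have hB := fromBlocks_toBlocks B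
  rw [← hA, ← hB, fromBlocks_multiply, ← fromBlocks_one, fromBlocks_inj] at hAB
  obtain ⟨-, h₁₂, -, h₂₂⟩ := hAB
  have h : A * fromBlocks 1 B.toBlocks₁₂ 0 B.toBlocks₂₂ =
      fromBlocks A.toBlocks₁₁ 0 A.toBlocks₂₁ 1 := by
    rw [← h₁₂, ← h₂₂]
    conv_lhs => rw [← hA]
    simp [fromBlocks_multiply]
  simpa using (congrArg det h).symm

theorem hfun_zero (s : ℤ) : hfun 0 s = 1 := by simp [hfun]

theorem hfun_of_neg {r : ℤ} (hr : r < 0) (s : ℤ) : hfun r s = 0 := by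
  simp [hfun, hr.not_gt, hr.ne]

/-- The entry at position `(b + r, b)` of the inverse of the unitriangular matrix
`(hfun (a - b) (b + 1))` indexed by integers `a`, `b`. -/
noncomputable def hinv (b : ℤ) : ℕ → NinthR
  | 0 => 1
  | r + 1 => -∑ k : Fin (r + 1), hfun ((r : ℤ) + 1 - (k : ℕ)) (b + (k : ℕ) + 1) * hinv b k

theorem sum_hfun_mul_hinv (b : ℤ) (r : ℕ) :
    ∑ k ∈ Finset.range (r + 1), hfun ((r : ℤ) - k) (b + k + 1) * hinv b k =
      if r = 0 then 1 else 0 := by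
  cases r with
  | zero => simp [hfun_zero, hinv]
  | succ r =>
    rw [Finset.sum_range_succ, sub_self, hfun_zero, one_mul, hinv, Finset.sum_range]
    simp

/-- The inverse of the unitriangular matrix `(hfun (a - b) (b + 1))` indexed by integers. -/
noncomputable def hinvMat (a b : ℤ) : NinthR := if b ≤ a then hinv b (a - b).toNat else 0

theorem sum_Ico_hfun_mul_hinvMat {lo hi a b : ℤ} (ha : a ∈ Finset.Ico lo hi)
    (hb : b ∈ Finset.Ico lo hi) :
    ∑ c ∈ Finset.Ico lo hi, hfun (a - c) (c + 1) * hinvMat c b = if a = b then 1 else 0 := by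
  rw [Finset.mem_Ico] at ha hb
  have hsub : Finset.Icc b a ⊆ Finset.Ico lo hi := by
    intro c
    simp only [Finset.mem_Icc, Finset.mem_Ico]
    omega
  rw [← Finset.sum_subset hsub]
  · rcases lt_or_ge a b with hab | hab
    · simp [Finset.Icc_eq_empty_of_lt hab, hab.ne]
    · obtain ⟨r, rfl⟩ : ∃ r : ℕ, a = b + r := ⟨(a - b).toNat, by omega⟩
      have h := sum_hfun_mul_hinv b r
      simp only [add_eq_left, Nat.cast_eq_zero]
      rw [← h]
      refine Finset.sum_bij' (fun c _ => (c - b).toNat) (fun k _ => b + k) ?_ ?_ ?_ ?_ ?_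
      · intro c hc; simp at hc ⊢; omega
      · intro c hc; simp at hc ⊢; omega
      · intro c hc; simp at hc ⊢; omega
      · intro c hc; simp
      · intro c hc
        rw [Finset.mem_Icc] at hc
        have : ((c - b).toNat : ℤ) = c - b := by omega
        rw [hinvMat, if_pos hc.1, this]
        congr 2 <;> ring
  · intro c _ hc
    rw [Finset.mem_Icc, not_and_or, not_le, not_le] at hc
    rcases hc with hc | hc
    · simp [hinvMat, hc.not_ge]
    · simp [hfun_of_neg (sub_neg.2 hc)]

theorem hfun_mul_hinvMat_eq_one {ι : Type*} [Fintype ι] [DecidableEq ι] {lo hi : ℤ}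
    {u v : ι → ℤ} (hu : Function.Injective u) (hv : Function.Injective v)
    (hu' : ∀ i, u i ∈ Finset.Ico lo hi) (hv' : Finset.univ.image v = Finset.Ico lo hi) :
    (Matrix.of fun i j => hfun (u i - v j) (v j + 1)) *
      (Matrix.of fun i j => hinvMat (v i) (u j)) = 1 := by
  ext i k : 1
  simp only [Matrix.mul_apply, Matrix.of_apply, Matrix.one_apply]
  simp_rw [← hu.eq_iff (a := i)]
  rw [← sum_Ico_hfun_mul_hinvMat (hu' i) (hu' k), ← hv', Finset.sum_image hv.injOn]

theorem evar_eq_neg_one_pow_mul_hinv (r : ℕ) (s : ℤ) :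
    evar r s = (-1) ^ r * hinv (s - r) r := by
  let u : Fin (r + 1) → ℤ := fun i => s - (i : ℕ)
  have hu : Function.Injective u := fun i j h => by
    simp only [u] at h
    omega
  have hu' : Finset.univ.image u = Finset.Ico (s - r) (s + 1) := by
    ext c
    simp only [u, Finset.mem_image, Finset.mem_univ, true_and, Finset.mem_Ico]
    exact ⟨by rintro ⟨i, rfl⟩; omega, fun h => ⟨⟨(s - c).toNat, by omega⟩, by simp; omega⟩⟩
  have hmem (i) : u i ∈ Finset.Ico (s - r) (s + 1) := by
    rw [← hu']
    exact Finset.mem_image_of_mem u (Finset.mem_univ i)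
  have hone := hfun_mul_hinvMat_eq_one hu hu hmem hu'
  set W : Matrix (Fin (r + 1)) (Fin (r + 1)) NinthR :=
    Matrix.of fun i j => hfun (u i - u j) (u j + 1) with hW
  have hdet : W.det = 1 := by
    rw [Matrix.det_of_isUpperTriangular]
    · simp [hW, hfun_zero]
    · intro i j hij
      have hij' : (j : ℕ) < i := hij
      exact hfun_of_neg (by simp only [u]; omega) _
  have hadj : W.adjugate = Matrix.of fun i j => hinvMat (u i) (u j) := by
    rw [← Matrix.mul_one W.adjugate, ← hone, ← Matrix.mul_assoc, Matrix.adjugate_mul, hdet,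
      one_smul, Matrix.one_mul]
  have hcorner := congrFun (congrFun hadj 0) (Fin.last r)
  rw [Matrix.adjugate_fin_succ_eq_det_submatrix, Matrix.of_apply] at hcorner
  have hL : hinvMat (u 0) (u (Fin.last r)) = hinv (s - r) r := by
    simp [hinvMat, u]
  rw [← hL, ← hcorner, evar, if_pos (by omega)]
  simp only [Fin.val_last, Fin.val_zero, add_zero]
  rw [← mul_assoc, ← mul_pow, neg_one_mul, neg_neg, one_pow, one_mul, Int.toNat_natCast]
  congr 1
  ext i j : 1
  simp only [hW, u, Matrix.of_apply, Matrix.submatrix_apply, Fin.succAbove_last,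
    Fin.succAbove_zero, Fin.val_castSucc, Fin.val_succ]
  congr 1 <;> push_cast <;> ring

theorem evar_eq_hinvMat {a b : ℤ} {n : ℕ} (hn : Even (a - b + n)) :
    evar (a - b) a = (-1) ^ n * hinvMat a b := by
  rcases lt_or_ge a b with hab | hab
  · simp [evar, hinvMat, hab.not_ge]
  · obtain ⟨r, rfl⟩ : ∃ r : ℕ, a = b + r := ⟨(a - b).toNat, by omega⟩
    have hrn : Even r ↔ Even n := by
      rw [add_sub_cancel_left, Int.even_add] at hn
      exact_mod_cast hn
    rw [add_sub_cancel_left, evar_eq_neg_one_pow_mul_hinv, hinvMat, if_pos hab]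
    simp [neg_one_pow_eq_ite, hrn]

theorem le_conjP_iff {l : ℕ → ℕ} (hl : ∀ i, 1 ≤ i → l (i + 1) ≤ l i) {q : ℕ}
    (hq : ∀ i, q < i → l i = 0) {i j : ℕ} (hi : 1 ≤ i) (hj : 1 ≤ j) :
    i ≤ conjP l j ↔ j ≤ l i := by
  have hanti {a b : ℕ} (ha : 1 ≤ a) (hab : a ≤ b) : l b ≤ l a := by
    induction b, hab using Nat.le_induction with
    | base => rfl
    | succ b hb ih => exact (hl b (ha.trans hb)).trans ih
  have hcard (n : ℕ) : (Set.Icc 1 n).ncard = n := by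
    simp [Set.ncard_eq_toFinset_card']
  constructor
  · contrapose!
    intro h
    have hsub : {k | 1 ≤ k ∧ j ≤ l k} ⊆ Set.Icc 1 (i - 1) := fun k hk => by
      refine ⟨hk.1, ?_⟩
      by_contra hki
      have := hanti hi (show i ≤ k by omega)
      have := hk.2
      omega
    have := Set.ncard_le_ncard hsub (Set.finite_Icc _ _)
    rw [hcard] at this
    rw [conjP]
    omega
  · intro h
    have hfin : {k | 1 ≤ k ∧ j ≤ l k}.Finite :=
      (Set.finite_Icc 1 q).subset fun k hk => ⟨hk.1, by
        by_contra hkq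
        have := hq k (by omega)
        have := hk.2
        omega⟩
    have := Set.ncard_le_ncard
      (fun k hk => ⟨hk.1, h.trans (hanti hk.1 hk.2)⟩ : Set.Icc 1 i ⊆ {k | 1 ≤ k ∧ j ≤ l k}) hfin
    rwa [hcard] at this

/-- The Maya diagram of a partition inside a `q × p` box: the positions `l i - i` of its rows
followed by the positions `j - 1 - l' j` of its columns. -/
noncomputable def maya (q p : ℕ) (l : ℕ → ℕ) : Fin q ⊕ Fin p → ℤ :=
  Sum.elim (fun i => (l (i + 1) : ℤ) - ((i : ℕ) + 1)) fun j => (j : ℕ) - (conjP l (j + 1) : ℤ)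

/-- `l` is a partition whose diagram fits in a `q × p` box; only the values of `l` at positive
indices matter. -/
structure IsBoxPartition (q p : ℕ) (l : ℕ → ℕ) : Prop where
  anti : ∀ i, 1 ≤ i → l (i + 1) ≤ l i
  eq_zero : ∀ i, q < i → l i = 0
  conj_eq_zero : ∀ j, p < j → conjP l j = 0

namespace IsBoxPartition

variable {q p : ℕ} {l : ℕ → ℕ}

theorem le_conjP_iff (h : IsBoxPartition q p l) (i j : ℕ) :
    i + 1 ≤ conjP l (j + 1) ↔ j + 1 ≤ l (i + 1) :=
  _root_.le_conjP_iff h.anti h.eq_zero i.succ_pos j.succ_pos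

theorem le_width (h : IsBoxPartition q p l) (i : ℕ) : l (i + 1) ≤ p := by
  have h₁ := h.le_conjP_iff i p
  have h₂ := h.conj_eq_zero (p + 1) p.lt_succ_self
  omega

theorem conjP_le (h : IsBoxPartition q p l) (j : ℕ) : conjP l (j + 1) ≤ q := by
  have h₁ := h.le_conjP_iff q j
  have h₂ := h.eq_zero (q + 1) q.lt_succ_self
  omega

theorem anti_of_le (h : IsBoxPartition q p l) {i k : ℕ} (hik : i ≤ k) :
    l (k + 1) ≤ l (i + 1) :=
  antitone_nat_of_succ_le (f := fun i => l (i + 1)) (fun i => h.anti (i + 1) i.succ_pos) hik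

theorem conjP_anti (h : IsBoxPartition q p l) {j k : ℕ} (hjk : j ≤ k) :
    conjP l (k + 1) ≤ conjP l (j + 1) := by
  rcases Nat.eq_zero_or_pos (conjP l (k + 1)) with hk | hk
  · simp [hk]
  · have h₁ := h.le_conjP_iff (conjP l (k + 1) - 1) k
    have h₂ := h.le_conjP_iff (conjP l (k + 1) - 1) j
    omega

theorem maya_inl_lt_inl (h : IsBoxPartition q p l) {i k : Fin q} (hik : i < k) :
    maya q p l (.inl k) < maya q p l (.inl i) := by
  have := h.anti_of_le hik.le
  simp only [maya, Sum.elim_inl]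
  omega

theorem maya_inr_lt_inr (h : IsBoxPartition q p l) {j k : Fin p} (hjk : j < k) :
    maya q p l (.inr j) < maya q p l (.inr k) := by
  have := h.conjP_anti hjk.le
  simp only [maya, Sum.elim_inr]
  omega

theorem maya_inl_lt_inr_iff (h : IsBoxPartition q p l) (i : Fin q) (j : Fin p) :
    maya q p l (.inl i) < maya q p l (.inr j) ↔ conjP l (j + 1) ≤ i := by
  have := h.le_conjP_iff i j
  simp only [maya, Sum.elim_inl, Sum.elim_inr]
  omega

theorem maya_inl_ne_inr (h : IsBoxPartition q p l) (i : Fin q) (j : Fin p) :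
    maya q p l (.inl i) ≠ maya q p l (.inr j) := by
  have := h.le_conjP_iff i j
  simp only [maya, Sum.elim_inl, Sum.elim_inr]
  omega

theorem maya_injective (h : IsBoxPartition q p l) : Function.Injective (maya q p l) := by
  rintro (i | i) (j | j) hij
  · rcases lt_trichotomy i j with hlt | rfl | hlt
    · exact absurd hij (h.maya_inl_lt_inl hlt).ne'
    · rfl
    · exact absurd hij (h.maya_inl_lt_inl hlt).ne
  · exact absurd hij (h.maya_inl_ne_inr i j)
  · exact absurd hij.symm (h.maya_inl_ne_inr j i)
  · rcases lt_trichotomy i j with hlt | rfl | hlt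
    · exact absurd hij (h.maya_inr_lt_inr hlt).ne
    · rfl
    · exact absurd hij (h.maya_inr_lt_inr hlt).ne'

theorem maya_mem_Ico (h : IsBoxPartition q p l) (x : Fin q ⊕ Fin p) :
    maya q p l x ∈ Finset.Ico (-(q : ℤ)) p := by
  rw [Finset.mem_Ico]
  rcases x with i | j
  · have := h.le_width i
    simp only [maya, Sum.elim_inl]
    omega
  · have := h.conjP_le j
    simp only [maya, Sum.elim_inr]
    omega

theorem image_maya (h : IsBoxPartition q p l) :
    Finset.univ.image (maya q p l) = Finset.Ico (-(q : ℤ)) p := by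
  refine Finset.eq_of_subset_of_card_le ?_ ?_
  · exact Finset.image_subset_iff.2 fun x _ => h.maya_mem_Ico x
  · rw [Finset.card_image_of_injective _ h.maya_injective]
    simp
    omega

theorem exists_perm (h : IsBoxPartition q p l) :
    ∃ σ : Equiv.Perm (Fin (q + p)),
      ∀ x, maya q p l x = ((σ (finSumFinEquiv x) : ℕ) : ℤ) - q := by
  have hmem (x) := Finset.mem_Ico.1 (h.maya_mem_Ico x)
  let f : Fin (q + p) → Fin (q + p) := fun k =>
    ⟨(maya q p l (finSumFinEquiv.symm k) + q).toNat, by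
      have := hmem (finSumFinEquiv.symm k)
      omega⟩
  have hf : Function.Injective f := fun k k' hkk => by
    have h₁ := hmem (finSumFinEquiv.symm k)
    have h₂ := hmem (finSumFinEquiv.symm k')
    simp only [f, Fin.mk.injEq] at hkk
    exact finSumFinEquiv.symm.injective (h.maya_injective (by omega))
  refine ⟨Equiv.ofBijective f (Finite.injective_iff_bijective.1 hf), fun x => ?_⟩
  have := hmem x
  simp only [f, Equiv.ofBijective_apply, Equiv.symm_apply_apply]
  omega

theorem sign_eq (h : IsBoxPartition q p l) {σ : Equiv.Perm (Fin (q + p))}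
    (hσ : ∀ x, maya q p l x = ((σ (finSumFinEquiv x) : ℕ) : ℤ) - q) :
    σ.sign = (∏ k : Fin q, ∏ i : Fin q, if i < k then -1 else 1) *
      ∏ j : Fin p, (-1) ^ conjP l (j + 1) := by
  have hlt (x y) : σ (finSumFinEquiv x) < σ (finSumFinEquiv y) ↔
      maya q p l x < maya q p l y := by
    rw [hσ, hσ, Fin.lt_def]
    omega
  have hsign : σ.sign = ∏ y : Fin q ⊕ Fin p, ∏ x : Fin q ⊕ Fin p,
      if finSumFinEquiv x < finSumFinEquiv y then
        if maya q p l x < maya q p l y then 1 else -1 else 1 := by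
    rw [Equiv.Perm.sign_eq_prod_prod_Iio, ← finSumFinEquiv.prod_comp]
    refine Finset.prod_congr rfl fun y _ => ?_
    simp_rw [← hlt]
    rw [finSumFinEquiv.prod_comp fun k => if k < finSumFinEquiv y then
      if σ k < σ (finSumFinEquiv y) then (1 : ℤˣ) else -1 else 1, ← Finset.prod_filter]
    congr 1
    ext k
    simp
  rw [hsign, Fintype.prod_sum_type]
  simp_rw [Fintype.prod_sum_type]
  congr 1
  · refine Finset.prod_congr rfl fun k _ => ?_
    rw [Finset.prod_eq_one (s := (Finset.univ : Finset (Fin p))), mul_one]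
    · refine Finset.prod_congr rfl fun i _ => ?_
      by_cases hik : i < k
      · simp [Fin.lt_def, Fin.lt_def.1 hik, (h.maya_inl_lt_inl hik).not_gt]
      · simp [Fin.lt_def, mt Fin.lt_def.2 hik]
    · intro j _
      have : ¬ finSumFinEquiv (Sum.inr j : Fin q ⊕ Fin p) < finSumFinEquiv (Sum.inl k) := by
        simp [Fin.lt_def]
        omega
      rw [if_neg this]
  · refine Finset.prod_congr rfl fun j _ => ?_
    rw [Finset.prod_eq_one (s := (Finset.univ : Finset (Fin p))), mul_one]
    · have hlt' (i : Fin q) :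
          finSumFinEquiv (Sum.inl i : Fin q ⊕ Fin p) < finSumFinEquiv (Sum.inr j) := by
        simp [Fin.lt_def]
        omega
      simp_rw [hlt', if_true, h.maya_inl_lt_inr_iff]
      rw [Fin.prod_univ_eq_prod_range (fun i => if conjP l (j + 1) ≤ i then (1 : ℤˣ) else -1),
        ← Finset.prod_range_mul_prod_Ico _ (h.conjP_le j),
        Finset.prod_congr rfl fun i hi => if_neg (Finset.mem_range.1 hi).not_ge,
        Finset.prod_congr rfl fun i hi => if_pos (Finset.mem_Ico.1 hi).1]
      simp
    · intro i _
      by_cases hij : i < j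
      · simp [h.maya_inr_lt_inr hij]
      · simp [hij]

theorem det_maya {m : ℕ → ℕ} (hl : IsBoxPartition q p l) (hm : IsBoxPartition q p m) :
    (Matrix.of fun x y => hfun (maya q p l x - maya q p m y) (maya q p m y + 1)).det =
      (∏ j : Fin p, (-1) ^ conjP l (j + 1)) * ∏ j : Fin p, (-1) ^ conjP m (j + 1) := by
  obtain ⟨σ, hσ⟩ := hl.exists_perm
  obtain ⟨τ, hτ⟩ := hm.exists_perm
  let W : Matrix (Fin (q + p)) (Fin (q + p)) NinthR :=
    Matrix.of fun i j => hfun ((i : ℕ) - (j : ℕ) : ℤ) ((j : ℕ) - q + 1)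
  have hW : W.det = 1 := by
    rw [Matrix.det_of_isLowerTriangular]
    · simp [W, hfun_zero]
    · intro i j hij
      have hij' : (i : ℕ) < j := hij
      exact hfun_of_neg (by omega) _
  have hsub : (Matrix.of fun x y => hfun (maya q p l x - maya q p m y) (maya q p m y + 1)) =
      ((W.submatrix σ id).submatrix id τ).submatrix finSumFinEquiv finSumFinEquiv := by
    ext x y : 1
    simp only [W, hσ, hτ, Matrix.of_apply, Matrix.submatrix_apply, id_eq]
    congr 1
    ring
  rw [hsub, Matrix.det_submatrix_equiv_self, Matrix.det_permute', Matrix.det_permute, hW,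
    hl.sign_eq hσ, hm.sign_eq hτ]
  set C : ℤˣ := ∏ k : Fin q, ∏ i : Fin q, if i < k then -1 else 1
  have hC : (((C : ℤˣ) : ℤ) : NinthR) * ((C : ℤ) : NinthR) = 1 := by
    rw [← Int.cast_mul, ← Units.val_mul, Int.units_mul_self]
    simp
  push_cast
  linear_combination (∏ j : Fin p, (-1 : NinthR) ^ conjP l (j + 1)) *
    (∏ j : Fin p, (-1) ^ conjP m (j + 1)) * hC

end IsBoxPartition

theorem det_evar_eq (l m : ℕ → ℕ) (p : ℕ) :
    (Matrix.of fun i j : Fin p =>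
        evar ((conjP l ((i : ℕ) + 1) : ℤ) - (conjP m ((j : ℕ) + 1) : ℤ)
            - (((i : ℕ) : ℤ) + 1) + (((j : ℕ) : ℤ) + 1))
          (-(conjP m ((j : ℕ) + 1) : ℤ) + (((j : ℕ) : ℤ) + 1) - 1)).det =
      (∏ j : Fin p, (-1) ^ conjP l (j + 1)) * (∏ j : Fin p, (-1) ^ conjP m (j + 1)) *
        (Matrix.of fun j i : Fin p => hinvMat ((j : ℕ) - (conjP m (j + 1) : ℤ))
          ((i : ℕ) - (conjP l (i + 1) : ℤ))).det := by
  have hentry (i j : Fin p) : evar ((conjP l ((i : ℕ) + 1) : ℤ) - (conjP m ((j : ℕ) + 1) : ℤ)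
            - (((i : ℕ) : ℤ) + 1) + (((j : ℕ) : ℤ) + 1))
          (-(conjP m ((j : ℕ) + 1) : ℤ) + (((j : ℕ) : ℤ) + 1) - 1) =
      (-1) ^ (conjP l (i + 1) + i) * ((-1) ^ (conjP m (j + 1) + j) *
        hinvMat ((j : ℕ) - (conjP m (j + 1) : ℤ)) ((i : ℕ) - (conjP l (i + 1) : ℤ))) := by
    rw [← mul_assoc, ← pow_add, ← evar_eq_hinvMat]
    · congr 1 <;> ring
    · exact ⟨(conjP l (i + 1) : ℤ) + (j : ℕ), by push_cast; ring⟩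
  simp_rw [hentry]
  have hcol := Matrix.det_mul_column (fun i : Fin p => (-1 : NinthR) ^ (conjP l (i + 1) + i))
    (Matrix.of fun i j : Fin p => (-1) ^ (conjP m (j + 1) + j) *
      hinvMat ((j : ℕ) - (conjP m (j + 1) : ℤ)) ((i : ℕ) - (conjP l (i + 1) : ℤ)))
  have hrow := Matrix.det_mul_row (fun j : Fin p => (-1 : NinthR) ^ (conjP m (j + 1) + j))
    (Matrix.of fun j i : Fin p => hinvMat ((j : ℕ) - (conjP m (j + 1) : ℤ))
      ((i : ℕ) - (conjP l (i + 1) : ℤ))).transpose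
  simp only [Matrix.of_apply, Matrix.transpose_apply] at hcol hrow
  rw [hcol, hrow, Matrix.det_transpose]
  simp_rw [pow_add, Finset.prod_mul_distrib]
  have hsq : (∏ j : Fin p, (-1 : NinthR) ^ (j : ℕ)) * ∏ j : Fin p, (-1 : NinthR) ^ (j : ℕ) = 1 := by
    rw [← Finset.prod_mul_distrib]
    exact Finset.prod_eq_one fun j _ => by rw [← mul_pow]; simp
  linear_combination (∏ j : Fin p, (-1 : NinthR) ^ conjP l (j + 1)) *
    (∏ j : Fin p, (-1) ^ conjP m (j + 1)) * (Matrix.of fun j i : Fin p =>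
      hinvMat ((j : ℕ) - (conjP m (j + 1) : ℤ)) ((i : ℕ) - (conjP l (i + 1) : ℤ))).det * hsq

/-- The dual Jacobi–Trudi identity for the ninth-variation Schur
functions: if `λ, μ` are partitions with `λ_i = μ_i = 0` for `i > q` and
`λ'_j = μ'_j = 0` for `j > p`, then `S_q(λ,μ;0)` equals the determinant of the `p × p`
matrix with `(i,j)` entry `e(λ'_i − μ'_j − i + j, −μ'_j + j − 1)`. -/
theorem stmt_19 (l μ : ℕ → ℕ)
    (hl : ∀ i, 1 ≤ i → l (i + 1) ≤ l i) (hμ : ∀ i, 1 ≤ i → μ (i + 1) ≤ μ i)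
    (q : ℕ) (hq : ∀ i, q < i → l i = 0 ∧ μ i = 0)
    (p : ℕ) (hp : ∀ j, p < j → conjP l j = 0 ∧ conjP μ j = 0) :
    Svar q l μ 0 =
      Matrix.det (Matrix.of fun i j : Fin p =>
        evar ((conjP l ((i : ℕ) + 1) : ℤ) - (conjP μ ((j : ℕ) + 1) : ℤ)
            - (((i : ℕ) : ℤ) + 1) + (((j : ℕ) : ℤ) + 1))
          (-(conjP μ ((j : ℕ) + 1) : ℤ) + (((j : ℕ) : ℤ) + 1) - 1)) := by
  have hl' : IsBoxPartition q p l := ⟨hl, fun i hi => (hq i hi).1, fun j hj => (hp j hj).1⟩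
  have hμ' : IsBoxPartition q p μ := ⟨hμ, fun i hi => (hq i hi).2, fun j hj => (hp j hj).2⟩
  rw [det_evar_eq, ← hl'.det_maya hμ']
  have hJ := det_toBlocks₁₁_eq_det_mul_det_toBlocks₂₂ (hfun_mul_hinvMat_eq_one
    hl'.maya_injective hμ'.maya_injective hl'.maya_mem_Ico hμ'.image_maya)
  refine Eq.trans ?_ hJ
  rw [Svar]
  congr 1
  ext i j : 1
  simp only [Matrix.toBlocks₁₁, Matrix.of_apply, maya, Sum.elim_inl]
  congr 1 <;> ring
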